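/- Let n ≥ 3 be an integer, λ ∈ {−1, 1}, t* ∈ ℝ, x* ∈ Eⁿ, and let ψ : ℝ × Eⁿ → ℝ be twice continuously differentiable and satisfy the decay condition at (t*, x*, λ). Then the functions x ↦ ‖x − x*‖^{2−n}·(□ψ)(t* + λ‖x − x*‖, x) and x ↦ ‖x − x*‖^{1−n}·(∂_tψ)(t* + λ‖x − x*‖, x) are Lebesgue integrable on Eⁿ. -/

import Mathlib

open MeasureTheory Real Filter

noncomputable def pd {n : ℕ} (i : Fin n) (f : EuclideanSpace ℝ (Fin n) → ℝ)
    (x : EuclideanSpace ℝ (Fin n)) : ℝ :=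
  fderiv ℝ f x (EuclideanSpace.single i 1)

noncomputable def pdT {n : ℕ} (ψ : ℝ × EuclideanSpace ℝ (Fin n) → ℝ)
    (p : ℝ × EuclideanSpace ℝ (Fin n)) : ℝ :=
  deriv (fun s => ψ (s, p.2)) p.1

noncomputable def pdX {n : ℕ} (i : Fin n) (ψ : ℝ × EuclideanSpace ℝ (Fin n) → ℝ)
    (p : ℝ × EuclideanSpace ℝ (Fin n)) : ℝ :=
  fderiv ℝ (fun y => ψ (p.1, y)) p.2 (EuclideanSpace.single i 1)

noncomputable def dAlem {n : ℕ} (ψ : ℝ × EuclideanSpace ℝ (Fin n) → ℝ)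
    (p : ℝ × EuclideanSpace ℝ (Fin n)) : ℝ :=
  (∑ i, pdX i (pdX i ψ) p) - pdT (pdT ψ) p
/-- The decay condition of ψ at (t*, x*, λ): beyond some radius r*, for each m ∈ {0,1,2}
there are p_m > m and C_m > 0 bounding every pure m-th order partial derivative of ψ
(with respect to the time variable or a single space coordinate), evaluated along the
biased argument, by C_m * ‖x - x*‖ ^ (-p_m). -/
def Decay {n : ℕ} (ψ : ℝ × EuclideanSpace ℝ (Fin n) → ℝ) (ts lam : ℝ)
    (xs : EuclideanSpace ℝ (Fin n)) : Prop :=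
  ∃ rs : ℝ, 0 < rs ∧
    (∃ p C : ℝ, 0 < p ∧ 0 < C ∧ ∀ x, rs < ‖x - xs‖ →
      |ψ (ts + lam * ‖x - xs‖, x)| ≤ C * ‖x - xs‖ ^ (-p)) ∧
    (∃ p C : ℝ, 1 < p ∧ 0 < C ∧ ∀ x, rs < ‖x - xs‖ →
      |pdT ψ (ts + lam * ‖x - xs‖, x)| ≤ C * ‖x - xs‖ ^ (-p) ∧
      ∀ i, |pdX i ψ (ts + lam * ‖x - xs‖, x)| ≤ C * ‖x - xs‖ ^ (-p)) ∧
    (∃ p C : ℝ, 2 < p ∧ 0 < C ∧ ∀ x, rs < ‖x - xs‖ →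
      |pdT (pdT ψ) (ts + lam * ‖x - xs‖, x)| ≤ C * ‖x - xs‖ ^ (-p) ∧
      ∀ i, |pdX i (pdX i ψ) (ts + lam * ‖x - xs‖, x)| ≤ C * ‖x - xs‖ ^ (-p))

open Set in
lemma aux_int {n : ℕ} (hn : 3 ≤ n) (k : ℕ) (hk : 1 ≤ k) (xs : EuclideanSpace ℝ (Fin n))
    (g : EuclideanSpace ℝ (Fin n) → ℝ) (hg : Continuous g) (R q C : ℝ) (hR : 0 < R)
    (hq : (k : ℝ) < q)
    (hb : ∀ x, R < ‖x - xs‖ → |g x| ≤ C * ‖x - xs‖ ^ (-q)) :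
    Integrable (fun x => ‖x - xs‖ ^ ((k : ℤ) - (n : ℤ)) * g x) := by
  haveI : Nontrivial (EuclideanSpace ℝ (Fin n)) := by
    haveI : Nonempty (Fin n) := ⟨⟨0, by omega⟩⟩
    infer_instance
  obtain ⟨M, hM⟩ := (isCompact_closedBall xs R).exists_bound_of_continuousOn hg.continuousOn
  let F : ℝ → ℝ := fun r => r ^ ((k : ℤ) - (n : ℤ)) * (if r ≤ R then M else C * r ^ (-q))
  have hF : Integrable (fun x : EuclideanSpace ℝ (Fin n) => F ‖x‖) := by
    rw [integrable_fun_norm_addHaar (μ := (volume : Measure (EuclideanSpace ℝ (Fin n)))) (f := F)]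
    rw [← Ioc_union_Ioi_eq_Ioi hR.le]
    have key : ∀ y : ℝ, 0 < y → y ^ (n - 1) * y ^ ((k : ℤ) - (n : ℤ)) = y ^ (k - 1) := by
      intro y hy
      rw [← zpow_natCast, ← zpow_natCast, ← zpow_add₀ hy.ne']
      congr 1
      omega
    refine IntegrableOn.union ?_ ?_
    · have h1 : IntegrableOn (fun y : ℝ => y ^ (k - 1) * M) (Ioc 0 R) :=
        ((by fun_prop : Continuous (fun y : ℝ => y ^ (k - 1) * M)).integrableOn_Icc).mono_set
          Ioc_subset_Icc_self
      refine h1.congr_fun ?_ measurableSet_Ioc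
      intro y hy
      simp only [F, finrank_euclideanSpace, Fintype.card_fin, smul_eq_mul, if_pos hy.2]
      rw [← mul_assoc, key y hy.1]
    · have h1 : IntegrableOn (fun y : ℝ => C * y ^ ((k : ℝ) - 1 - q)) (Ioi R) :=
        (integrableOn_Ioi_rpow_of_lt (by linarith) hR).const_mul C
      refine h1.congr_fun ?_ measurableSet_Ioi
      intro y hy
      have hy0 : 0 < y := hR.trans hy
      simp only [F, finrank_euclideanSpace, Fintype.card_fin, smul_eq_mul,
        if_neg (not_le.2 (mem_Ioi.1 hy))]
      rw [← mul_assoc, key y hy0, ← rpow_natCast, Nat.cast_sub hk, Nat.cast_one, sub_eq_add_neg _ q,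
        rpow_add hy0]
      ring
  refine (hF.comp_sub_right xs).mono' ?_ ?_
  · have h1 : Measurable (fun x : EuclideanSpace ℝ (Fin n) => ‖x - xs‖ ^ ((k : ℤ) - (n : ℤ))) := by
      have : Measurable (fun x : EuclideanSpace ℝ (Fin n) => ‖x - xs‖) := by fun_prop
      exact this.pow_const _
    exact (h1.mul hg.measurable).aestronglyMeasurable
  · refine Filter.Eventually.of_forall fun x => ?_
    have h0 : 0 ≤ ‖x - xs‖ ^ ((k : ℤ) - (n : ℤ)) := zpow_nonneg (norm_nonneg _) _
    simp only [F, norm_mul, Real.norm_of_nonneg h0]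
    refine mul_le_mul_of_nonneg_left ?_ h0
    split_ifs with h
    · exact hM x (by rwa [mem_closedBall_iff_norm])
    · exact hb x (not_le.1 h)

lemma pdT_eq {n : ℕ} {ψ : ℝ × EuclideanSpace ℝ (Fin n) → ℝ} (h : Differentiable ℝ ψ) :
    pdT ψ = fun p => fderiv ℝ ψ p (1, 0) := by
  funext p
  have h1 : HasDerivAt (fun s : ℝ => (s, p.2)) ((1 : ℝ), (0 : EuclideanSpace ℝ (Fin n))) p.1 :=
    (hasDerivAt_id _).prodMk (hasDerivAt_const _ _)
  exact ((h p).hasFDerivAt.comp_hasDerivAt p.1 h1).deriv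

lemma pdX_eq {n : ℕ} (i : Fin n) {ψ : ℝ × EuclideanSpace ℝ (Fin n) → ℝ}
    (h : Differentiable ℝ ψ) :
    pdX i ψ = fun p => fderiv ℝ ψ p (0, EuclideanSpace.single i 1) := by
  funext p
  have h1 := (h p).hasFDerivAt.comp p.2 (hasFDerivAt_prodMk_right (𝕜 := ℝ) p.1 p.2)
  have h2 := h1.fderiv
  unfold pdX
  change fderiv ℝ (ψ ∘ fun y => (p.1, y)) p.2 _ = _
  rw [h2]
  simp

lemma pdT_contDiff {n : ℕ} {ψ : ℝ × EuclideanSpace ℝ (Fin n) → ℝ} {m : ℕ}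
    (h : ContDiff ℝ (m + 1) ψ) : ContDiff ℝ m (pdT ψ) := by
  rw [pdT_eq (h.differentiable (by simp))]
  exact (h.fderiv_right le_rfl).clm_apply contDiff_const

lemma pdX_contDiff {n : ℕ} (i : Fin n) {ψ : ℝ × EuclideanSpace ℝ (Fin n) → ℝ} {m : ℕ}
    (h : ContDiff ℝ (m + 1) ψ) : ContDiff ℝ m (pdX i ψ) := by
  rw [pdX_eq i (h.differentiable (by simp))]
  exact (h.fderiv_right le_rfl).clm_apply contDiff_const

/-- under the decay condition, the two integrands of the boundary-free SIDF
are Lebesgue integrable on the whole space, n ≥ 3. -/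
theorem stmt_14 (n : ℕ) (hn : 3 ≤ n) (lam : ℝ) (hlam : lam = -1 ∨ lam = 1)
    (ts : ℝ) (xs : EuclideanSpace ℝ (Fin n))
    (ψ : ℝ × EuclideanSpace ℝ (Fin n) → ℝ) (hψ : ContDiff ℝ 2 ψ)
    (hdecay : Decay ψ ts lam xs) :
    Integrable (fun x : EuclideanSpace ℝ (Fin n) =>
      ‖x - xs‖ ^ (2 - (n : ℤ)) * dAlem ψ (ts + lam * ‖x - xs‖, x)) ∧
    Integrable (fun x : EuclideanSpace ℝ (Fin n) =>
      ‖x - xs‖ ^ (1 - (n : ℤ)) * pdT ψ (ts + lam * ‖x - xs‖, x)) := by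
  obtain ⟨R, hR, -, ⟨p1, C1, hp1, hC1, hb1⟩, ⟨p2, C2, hp2, hC2, hb2⟩⟩ := hdecay
  have hψ' : ContDiff ℝ ((1 : ℕ) + 1) ψ := by
    have : (((1 : ℕ) : WithTop ℕ∞) + 1) = 2 := by norm_num
    rw [this]; exact hψ
  have hT := pdT_contDiff hψ'
  have hX := fun i => pdX_contDiff i hψ'
  have hTT : Continuous (pdT (pdT ψ)) :=
    (pdT_contDiff (m := 0) (by simpa using hT)).continuous
  have hXX : ∀ i, Continuous (pdX i (pdX i ψ)) := fun i =>
    (pdX_contDiff (m := 0) i (by simpa using hX i)).continuous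
  have hA : Continuous (dAlem ψ) := by
    unfold dAlem
    exact (continuous_finsetSum _ fun i _ => hXX i).sub hTT
  have hc : Continuous (fun x : EuclideanSpace ℝ (Fin n) => (ts + lam * ‖x - xs‖, x)) := by
    fun_prop
  constructor
  · have := aux_int hn 2 (by norm_num) xs _ (hA.comp hc) R p2 ((n + 1) * C2) hR
      (by exact_mod_cast hp2) ?_
    · exact_mod_cast this
    · intro x hx
      obtain ⟨h1, h2⟩ := hb2 x hx
      simp only [Function.comp, dAlem]
      refine (abs_sub _ _).trans ?_
      have h3 := (Finset.abs_sum_le_sum_abs (fun i => pdX i (pdX i ψ) (ts + lam * ‖x - xs‖, x))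
        Finset.univ).trans (Finset.sum_le_sum fun i _ => h2 i)
      simp at h3
      nlinarith
  · have := aux_int hn 1 le_rfl xs _ (hT.continuous.comp hc) R p1 C1 hR
      (by exact_mod_cast hp1) (fun x hx => (hb1 x hx).1)
    exact_mod_cast this
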